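/- For every countable ordinal ξ with 1 ≤ ξ < ω₁, there exists a set A ⊆ 2^{<ω} such that the ω-power A^∞ is Ď_2(Σ^0_ξ)-complete: A^∞ can be written as B ∪ C with B ∈ Σ^0_ξ(2^ω) and C ∈ Π^0_ξ(2^ω), and for every zero-dimensional Polish space X and every set S ⊆ X of the form S = B' ∪ C' with B' ∈ Σ^0_ξ(X) and C' ∈ Π^0_ξ(X), there is a continuous map f : X → 2^ω with S = f⁻¹(A^∞); moreover A^∞ is not a difference of two Σ^0_ξ(2^ω) sets. -/

import Mathlib

open Topology MeasureTheory TopologicalSpace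

abbrev Cantor : Type := ℕ → Fin 2

/-- The concatenation of the first `m` words of the sequence `a`. -/
def concatPrefix {β : Type*} (a : ℕ → List β) (m : ℕ) : List β :=
  ((List.range m).map a).flatten

/-- The ω-power of a set `A` of finite words: the set of all infinite words obtained by
concatenating a sequence of words of `A` (infinitely many of them being nonempty). -/
def omegaPower {β : Type*} (A : Set (List β)) : Set (ℕ → β) :=
  {α | ∃ a : ℕ → List β, (∀ i, a i ∈ A) ∧
    (∀ n, ∃ m, n ≤ (concatPrefix a m).length) ∧
    ∀ (m k : ℕ) (h : k < (concatPrefix a m).length), (concatPrefix a m).get ⟨k, h⟩ = α k}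

/-- The Borel class Σ⁰_ξ of a topological space: Σ⁰_ξ is the class of open sets for ξ ≤ 1,
and for ξ ≥ 2 it consists of the countable unions of sets each lying in some Π⁰_η
with 1 ≤ η < ξ. -/
noncomputable def SigmaZero (X : Type*) [TopologicalSpace X] (ξ : Ordinal.{0}) : Set (Set X) :=
  if ξ ≤ 1 then {s | IsOpen s}
  else {s | ∃ f : ℕ → Set X,
    (∀ n, ∃ η : Ordinal.{0}, ∃ _ : 1 ≤ η, ∃ _ : η < ξ, (f n)ᶜ ∈ SigmaZero X η) ∧
    s = ⋃ n, f n}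
termination_by ξ

/-- The Borel class Π⁰_ξ: complements of Σ⁰_ξ sets. -/
noncomputable def PiZero (X : Type*) [TopologicalSpace X] (ξ : Ordinal.{0}) : Set (Set X) :=
  {s | sᶜ ∈ SigmaZero X ξ}

/-- A topological space is zero-dimensional if it has a basis consisting of clopen sets. -/
def ZeroDim (X : Type*) [TopologicalSpace X] : Prop :=
  ∃ b : Set (Set X), IsTopologicalBasis b ∧ ∀ s ∈ b, IsClopen s

section Hierarchy

variable {X Y : Type*} [TopologicalSpace X] [TopologicalSpace Y]

theorem mem_sigmaZero_of_le_one {ξ : Ordinal.{0}} (h : ξ ≤ 1) {s : Set X} :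
    s ∈ SigmaZero X ξ ↔ IsOpen s := by
  rw [SigmaZero, if_pos h]; rfl

theorem mem_sigmaZero_of_one_lt {ξ : Ordinal.{0}} (h : 1 < ξ) {s : Set X} :
    s ∈ SigmaZero X ξ ↔ ∃ f : ℕ → Set X,
      (∀ n, ∃ η : Ordinal.{0}, 1 ≤ η ∧ η < ξ ∧ f n ∈ PiZero X η) ∧ s = ⋃ n, f n := by
  rw [SigmaZero, if_neg (not_le.2 h)]
  simp only [Set.mem_ofPred_eq, PiZero, exists_prop]

theorem mem_piZero {ξ : Ordinal.{0}} {s : Set X} : s ∈ PiZero X ξ ↔ sᶜ ∈ SigmaZero X ξ :=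
  Iff.rfl

theorem compl_mem_piZero {ξ : Ordinal.{0}} {s : Set X} : sᶜ ∈ PiZero X ξ ↔ s ∈ SigmaZero X ξ := by
  rw [mem_piZero, compl_compl]

theorem preimage_mem_sigmaZero {f : X → Y} (hf : Continuous f) (ξ : Ordinal.{0}) :
    ∀ s ∈ SigmaZero Y ξ, f ⁻¹' s ∈ SigmaZero X ξ := by
  induction ξ using WellFoundedLT.induction with
  | ind ξ ih =>
    intro s hs
    rcases le_or_gt ξ 1 with h | h
    · rw [mem_sigmaZero_of_le_one h] at hs ⊢
      exact hs.preimage hf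
    · rw [mem_sigmaZero_of_one_lt h] at hs ⊢
      obtain ⟨g, hg, rfl⟩ := hs
      refine ⟨fun n => f ⁻¹' g n, fun n => ?_, Set.preimage_iUnion⟩
      obtain ⟨η, h1, h2, h3⟩ := hg n
      exact ⟨η, h1, h2, ih η h2 _ h3⟩

theorem preimage_mem_piZero {f : X → Y} (hf : Continuous f) {ξ : Ordinal.{0}} {s : Set Y}
    (hs : s ∈ PiZero Y ξ) : f ⁻¹' s ∈ PiZero X ξ :=
  preimage_mem_sigmaZero hf ξ _ hs

theorem iUnion_mem_sigmaZero {ξ : Ordinal.{0}} {s : ℕ → Set X} (hs : ∀ n, s n ∈ SigmaZero X ξ) :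
    ⋃ n, s n ∈ SigmaZero X ξ := by
  rcases le_or_gt ξ 1 with h | h
  · simp only [mem_sigmaZero_of_le_one h] at hs ⊢
    exact isOpen_iUnion hs
  · simp only [mem_sigmaZero_of_one_lt h] at hs ⊢
    choose f hf hf' using hs
    refine ⟨fun n => f n.unpair.1 n.unpair.2, fun n => hf _ _, ?_⟩
    simp only [hf']
    exact (Set.iUnion_unpair f).symm

theorem iInter_mem_piZero {ξ : Ordinal.{0}} {s : ℕ → Set X} (hs : ∀ n, s n ∈ PiZero X ξ) :
    ⋂ n, s n ∈ PiZero X ξ := by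
  rw [mem_piZero, Set.compl_iInter]
  exact iUnion_mem_sigmaZero hs

theorem union_mem_sigmaZero {ξ : Ordinal.{0}} {s t : Set X} (hs : s ∈ SigmaZero X ξ)
    (ht : t ∈ SigmaZero X ξ) : s ∪ t ∈ SigmaZero X ξ := by
  have : s ∪ t = ⋃ n : ℕ, if n = 0 then s else t := by
    ext x
    simp only [Set.mem_union, Set.mem_iUnion]
    constructor
    · rintro (h | h)
      · exact ⟨0, by simpa using h⟩
      · exact ⟨1, by simpa using h⟩
    · rintro ⟨n, hn⟩
      split_ifs at hn <;> tauto
  rw [this]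
  refine iUnion_mem_sigmaZero fun n => ?_
  split_ifs <;> assumption

theorem sigmaZero_of_piZero_of_lt {η ξ : Ordinal.{0}} (h1 : 1 ≤ η) (h : η < ξ) {s : Set X}
    (hs : s ∈ PiZero X η) : s ∈ SigmaZero X ξ := by
  rw [mem_sigmaZero_of_one_lt (h1.trans_lt h)]
  exact ⟨fun _ => s, fun _ => ⟨η, h1, h, hs⟩, (Set.iUnion_const s).symm⟩

theorem piZero_of_sigmaZero_of_lt {η ξ : Ordinal.{0}} (h1 : 1 ≤ η) (h : η < ξ) {s : Set X}
    (hs : s ∈ SigmaZero X η) : s ∈ PiZero X ξ :=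
  sigmaZero_of_piZero_of_lt h1 h (compl_mem_piZero.2 hs)

theorem IsClosed.mem_sigmaZero {ξ : Ordinal.{0}} (h : 1 < ξ) {s : Set X} (hs : IsClosed s) :
    s ∈ SigmaZero X ξ :=
  sigmaZero_of_piZero_of_lt le_rfl h ((mem_sigmaZero_of_le_one le_rfl).2 hs.isOpen_compl)

variable [MetrizableSpace X]

theorem IsOpen.mem_sigmaZero (ξ : Ordinal.{0}) {s : Set X} (hs : IsOpen s) :
    s ∈ SigmaZero X ξ := by
  rcases le_or_gt ξ 1 with h | h
  · exact (mem_sigmaZero_of_le_one h).2 hs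
  · let _ := metrizableSpaceMetric X
    obtain ⟨F, hF, -, rfl, -⟩ := hs.exists_iUnion_isClosed
    exact iUnion_mem_sigmaZero fun n => (hF n).mem_sigmaZero h

theorem sigmaZero_mono {η ξ : Ordinal.{0}} (h : η ≤ ξ) {s : Set X}
    (hs : s ∈ SigmaZero X η) : s ∈ SigmaZero X ξ := by
  rcases le_or_gt η 1 with h1 | h1
  · exact ((mem_sigmaZero_of_le_one h1).1 hs).mem_sigmaZero ξ
  · rw [mem_sigmaZero_of_one_lt h1] at hs
    rw [mem_sigmaZero_of_one_lt (h1.trans_le h)]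
    obtain ⟨f, hf, rfl⟩ := hs
    refine ⟨f, fun n => ?_, rfl⟩
    obtain ⟨ζ, h2, h3, h4⟩ := hf n
    exact ⟨ζ, h2, h3.trans_le h, h4⟩

theorem inter_mem_sigmaZero {ξ : Ordinal.{0}} {s t : Set X} (hs : s ∈ SigmaZero X ξ)
    (ht : t ∈ SigmaZero X ξ) : s ∩ t ∈ SigmaZero X ξ := by
  rcases le_or_gt ξ 1 with h | h
  · rw [mem_sigmaZero_of_le_one h] at *
    exact hs.inter ht
  · have ht' := ht
    rw [mem_sigmaZero_of_one_lt h] at hs ht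
    obtain ⟨f, hf, rfl⟩ := hs
    obtain ⟨g, hg, rfl⟩ := ht
    simp only [Set.iUnion_inter_iUnion]
    refine iUnion_mem_sigmaZero fun n => iUnion_mem_sigmaZero fun m => ?_
    obtain ⟨η, h1, h2, h3⟩ := hf n
    obtain ⟨ζ, h4, h5, h6⟩ := hg m
    refine sigmaZero_of_piZero_of_lt (h1.trans (le_max_left η ζ)) (max_lt h2 h5) ?_
    rw [mem_piZero, Set.compl_inter]
    exact union_mem_sigmaZero (sigmaZero_mono (le_max_left _ _) h3)
      (sigmaZero_mono (le_max_right _ _) h6)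

end Hierarchy

section ZeroDim

variable {X : Type*} [TopologicalSpace X] [SecondCountableTopology X]

/-- A second countable zero-dimensional space has a countable basis of clopen sets. -/
theorem ZeroDim.exists_basis (h : ZeroDim X) :
    ∃ b : ℕ → Set X, (∀ n, IsClopen (b n)) ∧ IsTopologicalBasis (Set.range b) := by
  obtain ⟨b, hb, hc⟩ := h
  obtain ⟨c, hcb, hc1, hc2⟩ := hb.exists_countable
  obtain ⟨f, hf⟩ := (hc1.insert ∅).exists_eq_range (Set.insert_nonempty _ _)
  refine ⟨f, fun n => ?_, hf ▸ hc2.insert_empty⟩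
  have hn : f n ∈ insert ∅ c := hf ▸ Set.mem_range_self n
  rcases hn with hn | hn
  · rw [hn]; exact isClopen_empty
  · exact hc _ (hcb hn)

theorem cantor_zeroDim : ZeroDim Cantor := by
  refine ⟨_, isTopologicalBasis_isClopen, fun s hs => hs⟩

theorem ZeroDim.exists_iUnion_isClopen (h : ZeroDim X) {s : Set X} (hs : IsOpen s) :
    ∃ U : ℕ → Set X, (∀ n, IsClopen (U n)) ∧ s = ⋃ n, U n := by
  classical
  obtain ⟨b, hb, hB⟩ := h.exists_basis
  refine ⟨fun n => if b n ⊆ s then b n else ∅, fun n => ?_, ?_⟩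
  · dsimp only
    split_ifs
    exacts [hb n, isClopen_empty]
  · ext x
    simp only [Set.mem_iUnion]
    constructor
    · intro hx
      obtain ⟨_, ⟨n, rfl⟩, h1, h2⟩ := hB.exists_subset_of_mem_open hx hs
      exact ⟨n, by rwa [if_pos h2]⟩
    · rintro ⟨n, hn⟩
      split_ifs at hn with h3
      exacts [h3 hn, hn.elim]

open Classical in
theorem ZeroDim.exists_isInducing (h : ZeroDim X) :
    ∃ ι : X → Cantor, IsInducing ι := by
  obtain ⟨b, hb, hB⟩ := h.exists_basis
  have hι : Continuous (fun x (n : ℕ) => if x ∈ b n then (1 : Fin 2) else 0) :=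
    continuous_pi fun n => by
      refine continuous_const.if (fun a ha => ?_) continuous_const
      have := (hb n).frontier_eq
      simp only [Set.ofPred_mem_eq, this] at ha
      exact ha.elim
  refine ⟨_, ⟨le_antisymm hι.le_induced ?_⟩⟩
  rw [hB.eq_generateFrom]
  refine le_generateFrom ?_
  rintro _ ⟨n, rfl⟩
  refine ⟨(fun y => y n) ⁻¹' {1}, (isOpen_discrete _).preimage (continuous_apply n), ?_⟩
  ext x
  by_cases hx : x ∈ b n <;> simp [hx]

end ZeroDim

theorem Topology.IsInducing.exists_sigmaZero {X Y : Type*} [TopologicalSpace X]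
    [TopologicalSpace Y] {ι : X → Y} (hι : IsInducing ι) (ξ : Ordinal.{0}) :
    ∀ s ∈ SigmaZero X ξ, ∃ t ∈ SigmaZero Y ξ, s = ι ⁻¹' t := by
  induction ξ using WellFoundedLT.induction with
  | ind ξ ih =>
    intro s hs
    rcases le_or_gt ξ 1 with h | h
    · simp only [mem_sigmaZero_of_le_one h] at hs ⊢
      obtain ⟨t, ht, rfl⟩ := hι.isOpen_iff.1 hs
      exact ⟨t, ht, rfl⟩
    · rw [mem_sigmaZero_of_one_lt h] at hs
      obtain ⟨g, hg, rfl⟩ := hs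
      choose η h1 h2 h3 using hg
      choose t ht ht' using fun n => ih (η n) (h2 n) _ (h3 n)
      refine ⟨⋃ n, (t n)ᶜ, iUnion_mem_sigmaZero fun n =>
        sigmaZero_of_piZero_of_lt (h1 n) (h2 n) (compl_mem_piZero.2 (ht n)), ?_⟩
      simp only [Set.preimage_iUnion, Set.preimage_compl, ← ht', compl_compl]

section Columns

variable {β : Type*}

/-- The `n`-th column of a sequence, for the pairing function `Nat.pair`. -/
def column (n : ℕ) (a : ℕ → β) : ℕ → β := fun k => a (Nat.pair n k)

/-- The sequence with prescribed columns. -/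
def ofColumns (g : ℕ → ℕ → β) : ℕ → β := fun k => g k.unpair.1 k.unpair.2

@[simp]
theorem column_ofColumns (n : ℕ) (g : ℕ → ℕ → β) : column n (ofColumns g) = g n := by
  funext k
  simp [column, ofColumns]

variable [TopologicalSpace β]

theorem continuous_column (n : ℕ) : Continuous (column n : (ℕ → β) → ℕ → β) :=
  continuous_pi fun _ => continuous_apply _

theorem continuous_ofColumns {X : Type*} [TopologicalSpace X] {g : X → ℕ → ℕ → β}
    (hg : ∀ n, Continuous fun x => g x n) : Continuous fun x => ofColumns (g x) :=
  continuous_pi fun k => (continuous_apply _).comp (hg k.unpair.1)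

end Columns

theorem countable_Iio_of_card_le {ξ : Ordinal.{0}} (h : ξ.card ≤ Cardinal.aleph0) :
    (Set.Iio ξ).Countable := by
  rw [← Cardinal.le_aleph0_iff_set_countable, Cardinal.mk_Iio_ordinal]
  exact Cardinal.lift_le_aleph0.2 h

/-- The class Σ⁰_ξ of the Cantor space has a universal set. -/
theorem exists_universal_sigmaZero (ξ : Ordinal.{0}) (hcount : ξ.card ≤ Cardinal.aleph0) :
    ∃ U ∈ SigmaZero (Cantor × Cantor) ξ, ∀ s ∈ SigmaZero Cantor ξ,
      ∃ a : Cantor, s = (fun x => (a, x)) ⁻¹' U := by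
  classical
  induction ξ using WellFoundedLT.induction with
  | ind ξ ih =>
    rcases le_or_gt ξ 1 with h | h
    · simp only [mem_sigmaZero_of_le_one h]
      obtain ⟨b, hb, hB⟩ := cantor_zeroDim.exists_basis
      refine ⟨⋃ n, (fun p : Cantor × Cantor => p.1 n) ⁻¹' {1} ∩ Prod.snd ⁻¹' b n,
        isOpen_iUnion fun n => ((isOpen_discrete _).preimage (by fun_prop)).inter
          ((hb n).isOpen.preimage continuous_snd), fun s hs => ?_⟩
      refine ⟨fun n => if b n ⊆ s then 1 else 0, ?_⟩
      ext x
      simp only [Set.mem_preimage, Set.mem_iUnion, Set.mem_inter_iff, Set.mem_singleton_iff]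
      constructor
      · intro hx
        obtain ⟨_, ⟨n, rfl⟩, h1, h2⟩ := hB.exists_subset_of_mem_open hx hs
        exact ⟨n, if_pos h2, h1⟩
      · rintro ⟨n, hn, hx⟩
        by_cases h3 : b n ⊆ s
        · exact h3 hx
        · simp [h3] at hn
    · have hcnt : (Set.Ico 1 ξ).Countable :=
        (countable_Iio_of_card_le hcount).mono fun η hη => hη.2
      obtain ⟨e, he⟩ := hcnt.exists_eq_range ⟨1, le_rfl, h⟩
      have he' : ∀ i, 1 ≤ e i ∧ e i < ξ := fun i => by
        have : e i ∈ Set.Ico 1 ξ := he ▸ Set.mem_range_self i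
        exact this
      choose U hU hU' using fun i => ih (e i) (he' i).2
        ((Ordinal.card_le_card (he' i).2.le).trans hcount)
      refine ⟨⋃ i, ⋃ m, (fun p : Cantor × Cantor => (column m (column i p.1), p.2)) ⁻¹' (U i)ᶜ,
        ?_, fun s hs => ?_⟩
      · refine iUnion_mem_sigmaZero fun i => iUnion_mem_sigmaZero fun m => ?_
        refine preimage_mem_sigmaZero ?_ _ _ ?_
        · exact (((continuous_column m).comp (continuous_column i)).comp continuous_fst).prodMk
            continuous_snd
        · exact sigmaZero_of_piZero_of_lt (he' i).1 (he' i).2 (compl_mem_piZero.2 (hU i))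
      · rw [mem_sigmaZero_of_one_lt h] at hs
        obtain ⟨f, hf, rfl⟩ := hs
        choose η h1 h2 h3 using hf
        have key : ∀ i m, ∃ a : Cantor,
            (if η m = e i then f m else ∅) = (fun x => (a, x)) ⁻¹' (U i)ᶜ := by
          intro i m
          have : (if η m = e i then f m else ∅)ᶜ ∈ SigmaZero Cantor (e i) := by
            split_ifs with hη
            · exact hη ▸ h3 m
            · rw [Set.compl_empty]
              exact isOpen_univ.mem_sigmaZero _
          obtain ⟨a, ha⟩ := hU' i _ this
          exact ⟨a, by rw [Set.preimage_compl, ← ha, compl_compl]⟩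
        choose a ha using key
        refine ⟨ofColumns fun i => ofColumns (a i), ?_⟩
        simp only [Set.preimage_iUnion]
        have : ∀ i m, (fun x : Cantor => (ofColumns fun i => ofColumns (a i), x)) ⁻¹'
            ((fun p : Cantor × Cantor => (column m (column i p.1), p.2)) ⁻¹' (U i)ᶜ) =
            if η m = e i then f m else ∅ := by
          intro i m
          rw [ha, ← Set.preimage_comp]
          congr 1
          funext x
          simp
        simp only [this]
        ext x
        simp only [Set.mem_iUnion]
        constructor
        · rintro ⟨m, hm⟩
          have : η m ∈ Set.range e := he ▸ ⟨h1 m, h2 m⟩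
          obtain ⟨i, hi⟩ := this
          exact ⟨i, m, by rwa [if_pos hi.symm]⟩
        · rintro ⟨i, m, hm⟩
          split_ifs at hm
          exacts [⟨m, hm⟩, hm.elim]

/-- The class of the sets of the form `B ∪ C` with `B` in Σ⁰_ξ and `C` in Π⁰_ξ. -/
def DualDiff (X : Type*) [TopologicalSpace X] (ξ : Ordinal.{0}) : Set (Set X) :=
  {s | ∃ B ∈ SigmaZero X ξ, ∃ C ∈ PiZero X ξ, s = B ∪ C}

/-- A set in the dual class of differences that reduces every set of the class in a
zero-dimensional Polish space, and is not itself a difference. -/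
theorem exists_complete_dualDiff (ξ : Ordinal.{0}) (hcount : ξ.card ≤ Cardinal.aleph0) :
    ∃ V ∈ DualDiff Cantor ξ,
      (∀ (X : Type) [TopologicalSpace X] [PolishSpace X], ZeroDim X →
        ∀ S ∈ DualDiff X ξ, ∃ f : X → Cantor, Continuous f ∧ S = f ⁻¹' V) ∧
      ¬ ∃ B ∈ SigmaZero Cantor ξ, ∃ C ∈ SigmaZero Cantor ξ, V = B \ C := by
  obtain ⟨U, hU, hU'⟩ := exists_universal_sigmaZero ξ hcount
  have hc : ∀ i, Continuous fun z : Cantor => (column i z, column 2 z) := fun i =>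
    (continuous_column i).prodMk (continuous_column 2)
  let V : Set Cantor := (fun z => (column 0 z, column 2 z)) ⁻¹' U ∪
    (fun z => (column 1 z, column 2 z)) ⁻¹' Uᶜ
  let g : Cantor → Cantor → Cantor → Cantor := fun a b x =>
    ofColumns fun n => if n = 0 then a else if n = 1 then b else x
  have hg : ∀ a b x, g a b x ∈ V ↔ (a, x) ∈ U ∨ (b, x) ∉ U := by
    intro a b x
    simp only [V, g, Set.mem_union, Set.mem_preimage, column_ofColumns, Set.mem_compl_iff]
    simp
  have hgc : ∀ {X : Type} [TopologicalSpace X] {a b c : X → Cantor}, Continuous a →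
      Continuous b → Continuous c → Continuous fun x => g (a x) (b x) (c x) := by
    intro X _ a b c ha hb hc
    refine continuous_ofColumns fun n => ?_
    split_ifs <;> assumption
  have key : ∀ B ∈ SigmaZero Cantor ξ, ∀ C ∈ PiZero Cantor ξ, ∃ a b, ∀ x,
      x ∈ B ∪ C ↔ g a b x ∈ V := by
    intro B hB C hC
    obtain ⟨a, ha⟩ := hU' B hB
    obtain ⟨b, hb⟩ := hU' Cᶜ hC
    refine ⟨a, b, fun x => ?_⟩
    rw [hg]
    have h1 : x ∈ B ↔ (a, x) ∈ U := by rw [ha]; rfl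
    have h2 : x ∈ Cᶜ ↔ (b, x) ∈ U := by rw [hb]; rfl
    rw [Set.mem_union, h1, ← h2, Set.mem_compl_iff, not_not]
  refine ⟨V, ⟨_, preimage_mem_sigmaZero (hc 0) _ _ hU, _,
    preimage_mem_piZero (hc 1) (compl_mem_piZero.2 hU), rfl⟩, ?_, ?_⟩
  · rintro X _ _ hX S ⟨B, hB, C, hC, rfl⟩
    obtain ⟨ι, hι⟩ := hX.exists_isInducing
    obtain ⟨B', hB', rfl⟩ := hι.exists_sigmaZero ξ B hB
    obtain ⟨C', hC', hC''⟩ := hι.exists_sigmaZero ξ Cᶜ hC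
    obtain ⟨a, b, hab⟩ := key B' hB' C'ᶜ (compl_mem_piZero.2 hC')
    refine ⟨fun x => g a b (ι x), hgc continuous_const continuous_const hι.continuous, ?_⟩
    ext x
    have hC3 : C = ι ⁻¹' C'ᶜ := by rw [Set.preimage_compl, ← hC'', compl_compl]
    rw [Set.mem_preimage, ← hab, hC3]
    rfl
  · rintro ⟨B, hB, C, hC, hV⟩
    let d : Cantor → Cantor := fun x => g (column 0 x) (column 1 x) x
    have hd : Continuous d := hgc (continuous_column 0) (continuous_column 1) continuous_id
    obtain ⟨a, b, hab⟩ := key _ (preimage_mem_sigmaZero hd _ _ hC) _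
      (preimage_mem_piZero hd (compl_mem_piZero.2 hB))
    have h := hab (g a b 0)
    have h1 : d (g a b 0) = g a b (g a b 0) := by
      simp only [d]
      congr 1 <;> simp [g]
    have h2 : g a b 0 ∈ d ⁻¹' C ∪ d ⁻¹' Bᶜ ↔ d (g a b 0) ∉ V := by
      rw [hV]
      simp only [Set.mem_union, Set.mem_preimage, Set.mem_compl_iff, Set.mem_sdiff]
      tauto
    rw [h2, h1] at h
    exact not_iff_self h

section Presentation

/-- The projection of the part of `F` whose second coordinate agrees with `v` on `I`. -/
def fiber (F : Set (Cantor × (ℕ → ℕ))) (I : Set ℕ) (v : ℕ → ℕ) : Set Cantor :=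
  {α | ∃ γ, (α, γ) ∈ F ∧ ∀ i ∈ I, γ i = v i}

/-- A set is presented in `Γ` if it is the projection of a closed set all of whose fibers over
boxes lie in `Γ`. -/
def IsPresented (Γ : Set (Set Cantor)) (s : Set Cantor) : Prop :=
  ∃ F : Set (Cantor × (ℕ → ℕ)), IsClosed F ∧ fiber F ∅ 0 = s ∧ ∀ I v, fiber F I v ∈ Γ

theorem isPresented_of_isClosed {Γ : Set (Set Cantor)} {s : Set Cantor} (hs : IsClosed s)
    (h : s ∈ Γ) : IsPresented Γ s := by
  have key : ∀ I v, fiber (Prod.fst ⁻¹' s) I v = s := fun I v => by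
    ext α
    exact ⟨fun ⟨_, h1, _⟩ => h1, fun h1 => ⟨v, h1, fun _ _ => rfl⟩⟩
  exact ⟨Prod.fst ⁻¹' s, hs.preimage continuous_fst, key _ _, fun I v => (key I v).symm ▸ h⟩

/-- The sequence with first term `n` followed by the sequence `γ`. -/
def prepend (n : ℕ) (γ : ℕ → ℕ) : ℕ → ℕ
  | 0 => n
  | k + 1 => γ k

/-- The disjoint sum of a sequence of subsets of `Cantor × (ℕ → ℕ)`. -/
def sumSet (F : ℕ → Set (Cantor × (ℕ → ℕ))) : Set (Cantor × (ℕ → ℕ)) :=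
  {p | (p.1, fun k => p.2 (k + 1)) ∈ F (p.2 0)}

theorem isClosed_sumSet {F : ℕ → Set (Cantor × (ℕ → ℕ))} (hF : ∀ n, IsClosed (F n)) :
    IsClosed (sumSet F) := by
  have : sumSet F = ⋂ n, ((fun p : Cantor × (ℕ → ℕ) => p.2 0) ⁻¹' {n}ᶜ ∪
      (fun p : Cantor × (ℕ → ℕ) => (p.1, fun k => p.2 (k + 1))) ⁻¹' F n) := by
    ext p
    simp only [sumSet, Set.mem_ofPred_eq, Set.mem_iInter, Set.mem_union, Set.mem_preimage,
      Set.mem_compl_iff, Set.mem_singleton_iff]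
    exact ⟨fun h n => or_iff_not_imp_left.2 fun hn => not_not.1 hn ▸ h,
      fun h => (h (p.2 0)).resolve_left fun hn => hn rfl⟩
  rw [this]
  exact isClosed_iInter fun n => ((isClosed_discrete _).preimage (by fun_prop)).union
    ((hF n).preimage (by fun_prop))

theorem fiber_sumSet_of_mem (F : ℕ → Set (Cantor × (ℕ → ℕ))) {I : Set ℕ} (v : ℕ → ℕ)
    (h : 0 ∈ I) :
    fiber (sumSet F) I v = fiber (F (v 0)) (Nat.succ ⁻¹' I) (fun k => v (k + 1)) := by
  ext α
  constructor
  · rintro ⟨γ, h1, h2⟩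
    have h3 := h2 0 h
    exact ⟨fun k => γ (k + 1), h3 ▸ h1, fun i hi => h2 _ hi⟩
  · rintro ⟨γ, h1, h2⟩
    refine ⟨prepend (v 0) γ, h1, fun i hi => ?_⟩
    cases i with
    | zero => rfl
    | succ i => exact h2 i hi

theorem fiber_sumSet_of_notMem (F : ℕ → Set (Cantor × (ℕ → ℕ))) {I : Set ℕ} (v : ℕ → ℕ)
    (h : 0 ∉ I) :
    fiber (sumSet F) I v = ⋃ n, fiber (F n) (Nat.succ ⁻¹' I) (fun k => v (k + 1)) := by
  ext α
  rw [Set.mem_iUnion]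
  constructor
  · rintro ⟨γ, h1, h2⟩
    exact ⟨γ 0, fun k => γ (k + 1), h1, fun i hi => h2 _ hi⟩
  · rintro ⟨n, γ, h1, h2⟩
    refine ⟨prepend n γ, h1, fun i hi => ?_⟩
    cases i with
    | zero => exact (h hi).elim
    | succ i => exact h2 i hi

theorem isPresented_iUnion {Γ : Set (Set Cantor)} {F : ℕ → Set (Cantor × (ℕ → ℕ))}
    (hF : ∀ n, IsClosed (F n)) (h : ∀ n I v, fiber (F n) I v ∈ Γ)
    (h' : ∀ I v, ⋃ n, fiber (F n) I v ∈ Γ) : IsPresented Γ (⋃ n, fiber (F n) ∅ 0) := by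
  refine ⟨sumSet F, isClosed_sumSet hF, ?_, fun I v => ?_⟩
  · rw [fiber_sumSet_of_notMem F _ (Set.notMem_empty 0)]
    rfl
  · by_cases h0 : 0 ∈ I
    · rw [fiber_sumSet_of_mem F v h0]
      exact h _ _ _
    · rw [fiber_sumSet_of_notMem F v h0]
      exact h' _ _

theorem isPresented_iInter {Γ : Set (Set Cantor)} {s : ℕ → Set Cantor}
    (hs : ∀ n, IsPresented Γ (s n))
    (h : ∀ t : ℕ → Set Cantor, (∀ n, t n ∈ Γ) → ⋂ n, t n ∈ Γ) :
    IsPresented Γ (⋂ n, s n) := by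
  choose F hF hF' hF'' using hs
  let G : Set (Cantor × (ℕ → ℕ)) := ⋂ n, (fun p => (p.1, column n p.2)) ⁻¹' F n
  have hG : ∀ I v, fiber G I v = ⋂ n, fiber (F n) (Nat.pair n ⁻¹' I) (column n v) := by
    intro I v
    ext α
    rw [Set.mem_iInter]
    constructor
    · rintro ⟨γ, h1, h2⟩ n
      exact ⟨column n γ, Set.mem_iInter.1 h1 n, fun i hi => h2 _ hi⟩
    · intro h1
      choose γ h2 h3 using h1
      refine ⟨ofColumns γ, Set.mem_iInter.2 fun n => ?_, fun i hi => ?_⟩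
      · simpa using h2 n
      · have := h3 i.unpair.1 i.unpair.2 (by simpa using hi)
        simpa [column, ofColumns] using this
  refine ⟨G, isClosed_iInter fun n => (hF n).preimage
    (continuous_fst.prodMk ((continuous_column n).comp continuous_snd)), ?_, fun I v => ?_⟩
  · rw [hG]
    exact Set.iInter_congr fun n => hF' n
  · rw [hG]
    exact h _ fun n => hF'' n _ _

theorem IsPresented.mono {Γ Γ' : Set (Set Cantor)} (h : Γ ⊆ Γ') {s : Set Cantor}
    (hs : IsPresented Γ s) : IsPresented Γ' s :=
  let ⟨F, h1, h2, h3⟩ := hs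
  ⟨F, h1, h2, fun I v => h (h3 I v)⟩

theorem isPresented_sigmaZero_and_piZero (ξ : Ordinal.{0}) (hξ : 1 ≤ ξ) :
    (∀ s ∈ SigmaZero Cantor ξ, IsPresented (SigmaZero Cantor ξ) s) ∧
    ∀ s ∈ PiZero Cantor ξ, IsPresented (PiZero Cantor ξ) s := by
  induction ξ using WellFoundedLT.induction with
  | ind ξ ih =>
    have hU : ∀ f : ℕ → Set Cantor, (∀ n, ∃ Γ ⊆ SigmaZero Cantor ξ, IsPresented Γ (f n)) →
        IsPresented (SigmaZero Cantor ξ) (⋃ n, f n) := by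
      intro f hf
      choose Γ hΓ F h1 h2 h3 using hf
      have := isPresented_iUnion h1 (fun n I v => hΓ n (h3 n I v))
        fun I v => iUnion_mem_sigmaZero fun n => hΓ n (h3 n I v)
      simpa only [h2] using this
    rcases le_or_gt ξ 1 with h | h
    · constructor
      · intro s hs
        obtain ⟨U, hU1, rfl⟩ :=
          cantor_zeroDim.exists_iUnion_isClopen ((mem_sigmaZero_of_le_one h).1 hs)
        exact hU U fun n => ⟨_, subset_rfl, isPresented_of_isClosed (hU1 n).isClosed
          ((hU1 n).isOpen.mem_sigmaZero ξ)⟩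
      · intro s hs
        exact isPresented_of_isClosed
          (isOpen_compl_iff.1 ((mem_sigmaZero_of_le_one h).1 hs)) hs
    · constructor
      · intro s hs
        obtain ⟨f, hf, rfl⟩ := (mem_sigmaZero_of_one_lt h).1 hs
        refine hU f fun n => ?_
        obtain ⟨η, h1, h2, h3⟩ := hf n
        exact ⟨_, fun t ht => sigmaZero_of_piZero_of_lt h1 h2 ht, (ih η h2 h1).2 _ h3⟩
      · intro s hs
        obtain ⟨f, hf, hf'⟩ := (mem_sigmaZero_of_one_lt h).1 (mem_piZero.1 hs)
        have : s = ⋂ n, (f n)ᶜ := by rw [← compl_compl s, hf', Set.compl_iUnion]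
        rw [this]
        refine isPresented_iInter (fun n => ?_) fun t ht => iInter_mem_piZero ht
        obtain ⟨η, h1, h2, h3⟩ := hf n
        exact ((ih η h2 h1).1 _ h3).mono fun t ht => piZero_of_sigmaZero_of_lt h1 h2 ht

theorem mem_dualDiff_of_sigmaZero {X : Type*} [TopologicalSpace X] {ξ : Ordinal.{0}} {s : Set X}
    [MetrizableSpace X] (hs : s ∈ SigmaZero X ξ) : s ∈ DualDiff X ξ := by
  refine ⟨s, hs, ∅, ?_, (Set.union_empty s).symm⟩
  rw [mem_piZero, Set.compl_empty]
  exact isOpen_univ.mem_sigmaZero ξ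

theorem mem_dualDiff_of_piZero {X : Type*} [TopologicalSpace X] {ξ : Ordinal.{0}} {s : Set X}
    [MetrizableSpace X] (hs : s ∈ PiZero X ξ) : s ∈ DualDiff X ξ :=
  ⟨∅, isOpen_empty.mem_sigmaZero ξ, s, hs, (Set.empty_union s).symm⟩

theorem isPresented_dualDiff {ξ : Ordinal.{0}} (hξ : 1 ≤ ξ) {s : Set Cantor}
    (hs : s ∈ DualDiff Cantor ξ) : IsPresented (DualDiff Cantor ξ) s := by
  obtain ⟨B, hB, C, hC, rfl⟩ := hs
  obtain ⟨F, hF, rfl, hF'⟩ := (isPresented_sigmaZero_and_piZero ξ hξ).1 B hB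
  obtain ⟨G, hG, rfl, hG'⟩ := (isPresented_sigmaZero_and_piZero ξ hξ).2 C hC
  have key : ∀ I v, ⋃ n : ℕ, fiber (if n = 0 then F else G) I v = fiber F I v ∪ fiber G I v := by
    intro I v
    ext α
    rw [Set.mem_iUnion]
    constructor
    · rintro ⟨n, hn⟩
      split_ifs at hn
      exacts [Or.inl hn, Or.inr hn]
    · rintro (h | h)
      exacts [⟨0, by simpa using h⟩, ⟨1, by simpa using h⟩]
  rw [← key]
  refine isPresented_iUnion (fun n => ?_) (fun n I v => ?_) fun I v => ?_
  · split_ifs <;> assumption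
  · split_ifs
    exacts [mem_dualDiff_of_sigmaZero (hF' I v), mem_dualDiff_of_piZero (hG' I v)]
  · rw [key]
    exact ⟨_, hF' I v, _, hG' I v, rfl⟩

/-- A presentation in which the whole space is the projection, and the given set is the
projection of the points whose second coordinate starts with `0`. -/
theorem exists_pointed_presentation {ξ : Ordinal.{0}} (hξ : 1 ≤ ξ) {s : Set Cantor}
    (hs : s ∈ DualDiff Cantor ξ) :
    ∃ F : Set (Cantor × (ℕ → ℕ)), IsClosed F ∧ (∀ α, ∃ γ, (α, γ) ∈ F) ∧
      (∀ α, α ∈ s ↔ ∃ γ, (α, γ) ∈ F ∧ γ 0 = 0) ∧ ∀ I v, fiber F I v ∈ DualDiff Cantor ξ := by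
  obtain ⟨F, hF, rfl, hF'⟩ := isPresented_dualDiff hξ hs
  have huniv : (Set.univ : Set Cantor) ∈ DualDiff Cantor ξ :=
    mem_dualDiff_of_sigmaZero (isOpen_univ.mem_sigmaZero ξ)
  have hfib : ∀ I v, fiber Set.univ I v = Set.univ := fun I v =>
    Set.eq_univ_of_forall fun α => ⟨v, trivial, fun _ _ => rfl⟩
  let G : ℕ → Set (Cantor × (ℕ → ℕ)) := fun n => if n = 0 then F else Set.univ
  refine ⟨sumSet G, isClosed_sumSet fun n => ?_, fun α => ⟨fun _ => 1, ?_⟩, fun α => ?_,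
    fun I v => ?_⟩
  · dsimp only [G]
    split_ifs
    exacts [hF, isClosed_univ]
  · simp [sumSet, G]
  · have := fiber_sumSet_of_mem G (I := {0}) 0 rfl
    have h2 : α ∈ fiber (sumSet G) {0} 0 ↔ ∃ γ, (α, γ) ∈ sumSet G ∧ γ 0 = 0 := by
      simp [fiber]
    rw [← h2, this]
    have h3 : Nat.succ ⁻¹' {0} = ∅ := by ext; simp
    rw [h3]
    rfl
  · by_cases h0 : 0 ∈ I
    · rw [fiber_sumSet_of_mem G v h0]
      dsimp only [G]
      split_ifs
      · exact hF' _ _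
      · rwa [hfib]
    · rw [fiber_sumSet_of_notMem G v h0]
      convert huniv
      refine Set.eq_univ_of_forall fun α => Set.mem_iUnion.2 ⟨1, ?_⟩
      simp [G, hfib]

end Presentation

section Segments

variable {β : Type*}

/-- The finite word `y a, …, y (b - 1)`. -/
def seg (y : ℕ → β) (a b : ℕ) : List β := (List.Ico a b).map y

@[simp]
theorem length_seg (y : ℕ → β) (a b : ℕ) : (seg y a b).length = b - a := by
  simp [seg]

theorem getElem_seg (y : ℕ → β) (a b i : ℕ) (h : i < (seg y a b).length) :
    (seg y a b)[i] = y (a + i) := by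
  simp [seg, List.Ico]

theorem seg_append (y : ℕ → β) {a b c : ℕ} (hab : a ≤ b) (hbc : b ≤ c) :
    seg y a b ++ seg y b c = seg y a c := by
  rw [seg, seg, seg, ← List.map_append, List.Ico.append_consecutive hab hbc]

theorem seg_eq_seg_iff {y z : ℕ → β} {a b c d : ℕ} :
    seg y a b = seg z c d ↔ b - a = d - c ∧ ∀ i < b - a, y (a + i) = z (c + i) := by
  constructor
  · intro h
    have hl := congrArg List.length h
    simp only [length_seg] at hl
    refine ⟨hl, fun i hi => ?_⟩
    rw [← getElem_seg y a b i (by simpa using hi),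
      ← getElem_seg z c d i (by simpa [← hl] using hi)]
    simp only [h]
  · rintro ⟨hl, h⟩
    refine List.ext_getElem (by simpa using hl) fun i h1 h2 => ?_
    rw [getElem_seg, getElem_seg]
    exact h i (by simpa using h1)

theorem concatPrefix_succ (a : ℕ → List β) (m : ℕ) :
    concatPrefix a (m + 1) = concatPrefix a m ++ a m := by
  simp [concatPrefix, List.range_succ]

theorem mem_omegaPower_iff {A : Set (List β)} (hA : [] ∉ A) {y : ℕ → β} :
    y ∈ omegaPower A ↔
      ∃ l : ℕ → ℕ, StrictMono l ∧ l 0 = 0 ∧ ∀ i, seg y (l i) (l (i + 1)) ∈ A := by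
  constructor
  · rintro ⟨a, ha, -, h⟩
    have hl : ∀ m, (concatPrefix a (m + 1)).length = (concatPrefix a m).length + (a m).length :=
      fun m => by rw [concatPrefix_succ, List.length_append]
    have hpos : ∀ m, 0 < (a m).length := fun m =>
      List.length_pos_iff.2 fun h0 => hA (h0 ▸ ha m)
    have hseg : ∀ m, concatPrefix a m = seg y 0 (concatPrefix a m).length := by
      intro m
      refine List.ext_getElem (by simp) fun i h1 h2 => ?_
      rw [getElem_seg, Nat.zero_add]
      exact h m i h1
    have hmono : StrictMono fun m => (concatPrefix a m).length :=
      strictMono_nat_of_lt_succ fun m => by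
        have := hl m
        have := hpos m
        lia
    refine ⟨_, hmono, rfl, fun i => ?_⟩
    have h1 : seg y (concatPrefix a i).length (concatPrefix a (i + 1)).length = a i := by
      refine List.append_cancel_left (as := concatPrefix a i) ?_
      rw [← concatPrefix_succ, hseg (i + 1), length_seg, Nat.sub_zero]
      conv_lhs => rw [hseg i, length_seg, Nat.sub_zero]
      exact seg_append y (Nat.zero_le _) (hmono (Nat.lt_succ_self i)).le
    exact h1 ▸ ha i
  · rintro ⟨l, hl, h0, h⟩
    have hseg : ∀ m, concatPrefix (fun i => seg y (l i) (l (i + 1))) m = seg y 0 (l m) := by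
      intro m
      induction m with
      | zero => simp [concatPrefix, h0, seg]
      | succ m ih =>
        rw [concatPrefix_succ, ih, seg_append y (Nat.zero_le _) (hl (Nat.lt_succ_self m)).le]
    refine ⟨_, h, fun n => ⟨n, ?_⟩, fun m k hk => ?_⟩
    · rw [hseg, length_seg]
      exact hl.le_apply
    · simp only [hseg, List.get_eq_getElem, getElem_seg, Nat.zero_add]

theorem mem_omegaPower_of_step {A : Set (List β)} (hA : [] ∉ A) {y : ℕ → β} (P : ℕ → Prop)
    (h0 : P 0) (hP : ∀ q, P q → ∃ m, q < m ∧ P m ∧ seg y q m ∈ A) : y ∈ omegaPower A := by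
  choose! g h1 h2 h3 using hP
  have hPl : ∀ i, P (g^[i] 0) := by
    intro i
    induction i with
    | zero => exact h0
    | succ i ih =>
      rw [Function.iterate_succ_apply']
      exact h2 _ ih
  refine (mem_omegaPower_iff hA).2 ⟨fun i => g^[i] 0, strictMono_nat_of_lt_succ fun i => ?_,
    rfl, fun i => ?_⟩
  · rw [Function.iterate_succ_apply']
    exact h1 _ (hPl i)
  · simp only [Function.iterate_succ_apply']
    exact h3 _ (hPl i)

/-- A strictly increasing sequence starting at `0` eventually jumps over any given point. -/
theorem exists_between_of_strictMono {l : ℕ → ℕ} (hl : StrictMono l) (h0 : l 0 = 0) (n : ℕ) :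
    ∃ i, l i ≤ n ∧ n < l (i + 1) := by
  classical
  have hex : ∃ i, n < l (i + 1) := ⟨n, (Nat.lt_succ_self n).trans_le hl.le_apply⟩
  refine ⟨Nat.find hex, ?_, Nat.find_spec hex⟩
  cases hk : Nat.find hex with
  | zero => simp [h0]
  | succ k => exact not_lt.1 (Nat.find_min hex (hk ▸ Nat.lt_succ_self k))

end Segments

section OpenCase

/-- The words of the ω-power used at the first level: `00`, `1`, and the words in which a `1` is
followed by a `0`. -/
def openWords : Set (List (Fin 2)) :=
  {w | w = [0, 0] ∨ w = [1] ∨ ∃ i : ℕ, w[i]? = some 1 ∧ w[i + 1]? = some 0}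

theorem nil_notMem_openWords : [] ∉ openWords := by
  simp [openWords]

theorem Fin.eq_zero_of_ne_one {x : Fin 2} (h : x ≠ 1) : x = 0 := by
  revert h; revert x; decide

theorem seg_mem_openWords_iff {y : Cantor} {a b : ℕ} :
    seg y a b ∈ openWords ↔ (b = a + 2 ∧ y a = 0 ∧ y (a + 1) = 0) ∨ (b = a + 1 ∧ y a = 1) ∨
      ∃ i, a ≤ i ∧ i + 1 < b ∧ y i = 1 ∧ y (i + 1) = 0 := by
  have h2 : seg y a (a + 2) = [y a, y (a + 1)] := by
    rw [seg, List.Ico.eq_cons (by lia), List.Ico.succ_singleton]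
    rfl
  have h1 : seg y a (a + 1) = [y a] := by
    rw [seg, List.Ico.succ_singleton]
    rfl
  have hlen := length_seg y a b
  rw [openWords, Set.mem_ofPred_eq]
  refine or_congr ⟨fun h => ?_, ?_⟩ (or_congr ⟨fun h => ?_, ?_⟩ ⟨?_, ?_⟩)
  · rw [h] at hlen
    have hb : b = a + 2 := by simp at hlen; lia
    rw [hb, h2] at h
    simpa [hb] using h
  · rintro ⟨rfl, h3, h4⟩
    rw [h2, h3, h4]
  · rw [h] at hlen
    have hb : b = a + 1 := by simp at hlen; lia
    rw [hb, h1] at h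
    simpa [hb] using h
  · rintro ⟨rfl, h3⟩
    rw [h1, h3]
  · rintro ⟨i, h3, h4⟩
    obtain ⟨h5, h6⟩ := List.getElem?_eq_some_iff.1 h3
    obtain ⟨h7, h8⟩ := List.getElem?_eq_some_iff.1 h4
    rw [getElem_seg] at h6 h8
    rw [hlen] at h7
    exact ⟨a + i, by lia, by lia, h6, h8⟩
  · rintro ⟨i, h3, h4, h5, h6⟩
    refine ⟨i - a, List.getElem?_eq_some_iff.2 ⟨by lia, ?_⟩,
      List.getElem?_eq_some_iff.2 ⟨by lia, ?_⟩⟩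
    · rw [getElem_seg, ← h5]
      congr 1
      lia
    · rw [getElem_seg, ← h6]
      congr 1
      lia

theorem mem_omegaPower_openWords_iff {y : Cantor} :
    y ∈ omegaPower openWords ↔
      (∃ i, y i = 1 ∧ y (i + 1) = 0) ∨ ∀ n, ¬(y (2 * n) = 0 ∧ y (2 * n + 1) = 1) := by
  constructor
  · rw [mem_omegaPower_iff nil_notMem_openWords]
    rintro ⟨l, hl, h0, h⟩
    refine or_iff_not_imp_left.2 fun hno n ⟨hn0, hn1⟩ => ?_
    simp only [seg_mem_openWords_iff] at h
    have hz : ∀ k, ∀ i, i + k = 2 * n → y i = 0 := by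
      intro k
      induction k with
      | zero => rintro i rfl; exact hn0
      | succ k ih =>
        intro i hi
        exact Fin.eq_zero_of_ne_one fun h1 => hno ⟨i, h1, ih (i + 1) (by lia)⟩
    have hstep : ∀ i, l i ≤ 2 * n → l (i + 1) = l i + 2 := by
      intro i hi
      have h1 := hz (2 * n - l i) (l i) (by lia)
      rcases h i with h2 | ⟨-, h2⟩ | ⟨j, -, -, h2⟩
      · exact h2.1
      · rw [h1] at h2
        exact absurd h2 (by decide)
      · exact absurd ⟨j, h2⟩ hno
    have heven : ∀ i, l i ≤ 2 * n → 2 ∣ l i := by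
      intro i
      induction i with
      | zero => simp [h0]
      | succ i ih =>
        intro hi
        have h1 : l i ≤ 2 * n := (hl (Nat.lt_succ_self i)).le.trans hi
        have := hstep i h1
        have := ih h1
        lia
    obtain ⟨i, h1, h2⟩ := exists_between_of_strictMono hl h0 (2 * n)
    have h3 := hstep i h1
    have h4 := heven i h1
    have h5 : l i = 2 * n := by lia
    rcases h i with ⟨-, -, h6⟩ | ⟨h6, -⟩ | ⟨j, -, -, h6⟩
    · rw [h5, hn1] at h6
      exact absurd h6 (by decide)
    · lia
    · exact hno ⟨j, h6⟩
  · intro h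
    by_cases hinf : ∀ q, ∃ i, q ≤ i ∧ y i = 1 ∧ y (i + 1) = 0
    · refine mem_omegaPower_of_step nil_notMem_openWords (fun _ => True) trivial fun q _ => ?_
      obtain ⟨i, h1, h2⟩ := hinf q
      exact ⟨i + 2, by lia, trivial, seg_mem_openWords_iff.2 (.inr (.inr ⟨i, h1, by lia, h2⟩))⟩
    by_cases hex : ∃ i, y i = 1 ∧ y (i + 1) = 0
    · obtain ⟨i, hi⟩ := hex
      push Not at hinf
      obtain ⟨N, hN⟩ := hinf
      have hfirst : ∀ m, i + 1 < m → seg y 0 m ∈ openWords := fun m hm =>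
        seg_mem_openWords_iff.2 (.inr (.inr ⟨i, Nat.zero_le _, hm, hi⟩))
      by_cases hone : ∃ q, N ≤ q ∧ y q = 1
      · obtain ⟨q, hq, hq1⟩ := hone
        have hall : ∀ k, y (q + k) = 1 := by
          intro k
          induction k with
          | zero => exact hq1
          | succ k ih =>
            by_contra h1
            exact hN (q + k) (by lia) ih (Fin.eq_zero_of_ne_one h1)
        refine mem_omegaPower_of_step nil_notMem_openWords (fun r => r = 0 ∨ q < r) (.inl rfl) ?_
        rintro r (rfl | hr)
        · exact ⟨q + i + 2, by lia, .inr (by lia), hfirst _ (by lia)⟩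
        · refine ⟨r + 1, by lia, .inr (by lia), seg_mem_openWords_iff.2 (.inr (.inl ⟨rfl, ?_⟩))⟩
          have := hall (r - q)
          rwa [Nat.add_sub_cancel' hr.le] at this
      · push Not at hone
        have hz : ∀ r, N ≤ r → y r = 0 := fun r hr => Fin.eq_zero_of_ne_one (hone r hr)
        refine mem_omegaPower_of_step nil_notMem_openWords (fun r => r = 0 ∨ N ≤ r) (.inl rfl) ?_
        rintro r (rfl | hr)
        · exact ⟨N + i + 2, by lia, .inr (by lia), hfirst _ (by lia)⟩
        · exact ⟨r + 2, by lia, .inr (by lia), seg_mem_openWords_iff.2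
            (.inl ⟨rfl, hz r hr, hz (r + 1) (by lia)⟩)⟩
    · have hpar := h.resolve_left hex
      refine mem_omegaPower_of_step nil_notMem_openWords (fun q => 2 ∣ q ∨ y q = 1)
        (.inl (dvd_zero 2)) fun q hq => ?_
      by_cases h1 : y q = 1
      · refine ⟨q + 1, by lia, .inr ?_, seg_mem_openWords_iff.2 (.inr (.inl ⟨rfl, h1⟩))⟩
        by_contra h2
        exact hex ⟨q, h1, Fin.eq_zero_of_ne_one h2⟩
      · obtain ⟨n, rfl⟩ := hq.resolve_right h1
        have h2 := Fin.eq_zero_of_ne_one h1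
        have h3 : y (2 * n + 1) = 0 := Fin.eq_zero_of_ne_one fun h3 => hpar n ⟨h2, h3⟩
        exact ⟨2 * n + 2, by lia, .inl ⟨n + 1, by ring⟩,
          seg_mem_openWords_iff.2 (.inl ⟨rfl, h2, h3⟩)⟩

theorem isClopen_coord (i : ℕ) (c : Fin 2) : IsClopen {y : Cantor | y i = c} :=
  (isClopen_discrete {c}).preimage (continuous_apply i)

theorem omegaPower_openWords_mem_dualDiff {ξ : Ordinal.{0}} (h : ξ ≤ 1) :
    omegaPower openWords ∈ DualDiff Cantor ξ := by
  refine ⟨⋃ i, {y | y i = 1} ∩ {y | y (i + 1) = 0}, (mem_sigmaZero_of_le_one h).2 <|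
    isOpen_iUnion fun i => (isClopen_coord _ _).isOpen.inter (isClopen_coord _ _).isOpen,
    (⋃ n, {y | y (2 * n) = 0} ∩ {y | y (2 * n + 1) = 1})ᶜ,
    compl_mem_piZero.2 <| (mem_sigmaZero_of_le_one h).2 <|
    isOpen_iUnion fun i => (isClopen_coord _ _).isOpen.inter (isClopen_coord _ _).isOpen, ?_⟩
  ext y
  rw [mem_omegaPower_openWords_iff]
  simp

open Classical in
theorem exists_reduction_openWords {ξ : Ordinal.{0}} (h : ξ ≤ 1) {X : Type*} [TopologicalSpace X]
    [SecondCountableTopology X] (hX : ZeroDim X) {s : Set X} (hs : s ∈ DualDiff X ξ) :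
    ∃ f : X → Cantor, Continuous f ∧ s = f ⁻¹' omegaPower openWords := by
  obtain ⟨B, hB, C, hC, rfl⟩ := hs
  obtain ⟨U, hU, rfl⟩ := hX.exists_iUnion_isClopen ((mem_sigmaZero_of_le_one h).1 hB)
  obtain ⟨W, hW, hCW⟩ := hX.exists_iUnion_isClopen ((mem_sigmaZero_of_le_one h).1 hC)
  let f : X → Cantor := fun x i =>
    if x ∈ ⋃ j ∈ Finset.range i, U j then (if 2 ∣ i then 0 else 1)
    else if x ∈ ⋃ j ∈ (Finset.range i).filter (fun j => 2 * j + 1 ≤ i), W j then 1 else 0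
  have hf1 : ∀ x i, (∃ j < i, x ∈ U j) → f x i = if 2 ∣ i then 0 else 1 := by
    intro x i hx
    exact if_pos (by simpa using hx)
  have hf2 : ∀ x, (∀ j, x ∉ U j) → ∀ i, f x i = 1 ↔ ∃ j, 2 * j + 1 ≤ i ∧ x ∈ W j := by
    intro x hx i
    have h1 : x ∉ ⋃ j ∈ Finset.range i, U j := by simpa using fun j _ => hx j
    simp only [f, if_neg h1]
    split_ifs with h2
    · simp only [Set.mem_iUnion, Finset.mem_filter, exists_prop] at h2
      obtain ⟨j, ⟨-, h3⟩, h4⟩ := h2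
      exact iff_of_true rfl ⟨j, h3, h4⟩
    · refine iff_of_false (by decide) ?_
      rintro ⟨j, h3, h4⟩
      exact h2 (Set.mem_biUnion (Finset.mem_coe.2 (Finset.mem_filter.2
        ⟨Finset.mem_range.2 (by lia), h3⟩)) h4)
  refine ⟨f, continuous_pi fun i => ?_, ?_⟩
  · have hif : ∀ (t : Set X), IsClopen t → ∀ g k : X → Fin 2, Continuous g → Continuous k →
        Continuous fun x => if x ∈ t then g x else k x := by
      intro t ht g k hg hk
      refine hg.if (fun a ha => ?_) hk
      rw [Set.ofPred_mem_eq, ht.frontier_eq] at ha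
      exact ha.elim
    refine hif _ (isClopen_biUnion_finset fun j _ => hU j) _ _ continuous_const ?_
    exact hif _ (isClopen_biUnion_finset fun j _ => hW j) _ _ continuous_const continuous_const
  · ext x
    rw [Set.mem_preimage, mem_omegaPower_openWords_iff, Set.mem_union, Set.mem_iUnion]
    by_cases hx : ∃ j, x ∈ U j
    · refine iff_of_true (.inl hx) (.inl ?_)
      obtain ⟨j, hj⟩ := hx
      refine ⟨2 * j + 1, ?_, ?_⟩
      · rw [hf1 x _ ⟨j, by lia, hj⟩, if_neg (by lia)]
      · rw [hf1 x _ ⟨j, by lia, hj⟩, if_pos (by lia)]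
    · have hx' := not_exists.1 hx
      have hW' : x ∈ C ↔ ∀ j, x ∉ W j := by
        rw [← not_iff_not, ← Set.mem_compl_iff, hCW]
        simp
      have hmono : ¬∃ i, f x i = 1 ∧ f x (i + 1) = 0 := by
        rintro ⟨i, h1, h2⟩
        obtain ⟨j, h3, h4⟩ := (hf2 x hx' i).1 h1
        rw [(hf2 x hx' (i + 1)).2 ⟨j, by lia, h4⟩] at h2
        exact absurd h2 (by decide)
      rw [or_iff_right hx, or_iff_right hmono, hW']
      constructor
      · rintro h1 n ⟨-, h2⟩
        obtain ⟨j, -, h3⟩ := (hf2 x hx' _).1 h2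
        exact h1 j h3
      · intro h1 j hj
        have hex : ∃ j, x ∈ W j := ⟨j, hj⟩
        refine h1 (Nat.find hex) ⟨?_, (hf2 x hx' _).2 ⟨_, le_rfl, Nat.find_spec hex⟩⟩
        refine Fin.eq_zero_of_ne_one fun h2 => ?_
        obtain ⟨k, h3, h4⟩ := (hf2 x hx' _).1 h2
        exact Nat.find_min hex (by lia) h4

end OpenCase

section Spread

/-- The offset of `T` from the largest square below it. -/
def squareOffset (T : ℕ) : ℕ := T - T.sqrt * T.sqrt

/-- The sparse sequence which vanishes off the powers of `2`, has value `1` at `2 ^ (J * J)`, and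
value `α b` at `2 ^ (J * J + b + 1)` for `b < 2 * J`. -/
def spread (α : Cantor) : Cantor := fun m =>
  if 2 ^ Nat.log 2 m = m then
    if squareOffset (Nat.log 2 m) = 0 then 1 else α (squareOffset (Nat.log 2 m) - 1)
  else 0

theorem spread_pow (α : Cantor) (T : ℕ) :
    spread α (2 ^ T) = if squareOffset T = 0 then 1 else α (squareOffset T - 1) := by
  simp [spread, Nat.log_pow]

theorem exists_pow_of_spread_eq_one {α : Cantor} {m : ℕ} (h : spread α m = 1) :
    ∃ T, m = 2 ^ T := by
  by_contra hm
  rw [spread, if_neg fun h2 => hm ⟨_, h2.symm⟩] at h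
  exact absurd h (by decide)

theorem squareOffset_mul_self_add {J r : ℕ} (h : r ≤ 2 * J) : squareOffset (J * J + r) = r := by
  rw [squareOffset, Nat.sqrt_add_eq J (by lia), Nat.add_sub_cancel_left]

theorem spread_marker (α : Cantor) (J : ℕ) : spread α (2 ^ (J * J)) = 1 := by
  have h := squareOffset_mul_self_add (J := J) (r := 0) (Nat.zero_le _)
  rw [Nat.add_zero] at h
  rw [spread_pow, if_pos h]

theorem spread_bit (α : Cantor) {J b : ℕ} (h : b < 2 * J) :
    spread α (2 ^ (J * J + b + 1)) = α b := by
  have := squareOffset_mul_self_add (J := J) (r := b + 1) h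
  rw [spread_pow, add_assoc, this, if_neg (Nat.succ_ne_zero b), Nat.add_sub_cancel]

theorem spread_congr {α δ : Cantor} {m : ℕ}
    (h : α (squareOffset (Nat.log 2 m) - 1) = δ (squareOffset (Nat.log 2 m) - 1)) :
    spread α m = spread δ m := by
  simp only [spread, h]

theorem exists_le_spread_eq_one (α : Cantor) (N : ℕ) : ∃ i, N ≤ i ∧ spread α i = 1 :=
  ⟨2 ^ (N * N), (Nat.le_mul_self N).trans Nat.lt_two_pow_self.le, spread_marker α N⟩

theorem continuous_spread : Continuous spread := by
  refine continuous_pi fun m => ?_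
  unfold spread
  split_ifs
  exacts [continuous_const, continuous_apply _, continuous_const]

/-- Two distinct powers of `2` are determined by their difference. -/
theorem eq_of_add_eq_pow {p q i j a b c d : ℕ} (hij : i < j) (h1 : p + i = 2 ^ a)
    (h2 : p + j = 2 ^ b) (h3 : q + i = 2 ^ c) (h4 : q + j = 2 ^ d) : p = q := by
  have key : ∀ {p q a b c d : ℕ}, p + i = 2 ^ a → p + j = 2 ^ b → q + i = 2 ^ c →
      q + j = 2 ^ d → ¬a < c := by
    intro p q a b c d h1 h2 h3 h4 hac
    have hab : a < b := (Nat.pow_lt_pow_iff_right (le_refl 2)).1 (by lia)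
    have hcd : c < d := (Nat.pow_lt_pow_iff_right (le_refl 2)).1 (by lia)
    have h5 : 2 ^ b + 2 ^ c = 2 ^ d + 2 ^ a := by lia
    have h6 : 2 ^ (a + 1) ∣ 2 ^ d + 2 ^ a := h5 ▸
      dvd_add (pow_dvd_pow 2 hab) (pow_dvd_pow 2 hac)
    have h7 := (Nat.dvd_add_right (pow_dvd_pow 2 (by lia : a + 1 ≤ d))).1 h6
    exact absurd ((Nat.pow_dvd_pow_iff_le_right (le_refl 2)).1 h7) (by lia)
  have hac : a = c := le_antisymm (not_lt.1 (key h3 h4 h1 h2)) (not_lt.1 (key h1 h2 h3 h4))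
  subst hac
  lia

/-- The tail of the sparse sequence of `δ` starting at position `p`. -/
def spreadTail (p : ℕ) (δ : Cantor) : Cantor := fun i => spread δ (p + i)

theorem exists_le_spreadTail_eq_one (p : ℕ) (α : Cantor) (N : ℕ) :
    ∃ i, N ≤ i ∧ spreadTail p α i = 1 := by
  obtain ⟨i, h1, h2⟩ := exists_le_spread_eq_one α (p + N)
  refine ⟨i - p, by lia, ?_⟩
  rwa [spreadTail, Nat.add_sub_cancel' (by lia)]

theorem continuous_spreadTail (p : ℕ) : Continuous (spreadTail p) :=
  continuous_pi fun i => (continuous_apply (p + i)).comp continuous_spread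

/-- A position of the bit `b` after position `p`. -/
def bitPosition (p b : ℕ) : ℕ := 2 ^ ((p + b + 1) * (p + b + 1) + b + 1)

theorem le_bitPosition (p b : ℕ) : p ≤ bitPosition p b := by
  have h1 := Nat.le_mul_self (p + b + 1)
  have h2 : (p + b + 1) * (p + b + 1) + b + 1 < bitPosition p b := Nat.lt_two_pow_self
  lia

theorem spread_bitPosition (δ : Cantor) (p b : ℕ) : spread δ (bitPosition p b) = δ b :=
  spread_bit δ (by lia)

/-- The inverse of `spreadTail p`. -/
def decode (p : ℕ) (y : Cantor) : Cantor := fun b => y (bitPosition p b - p)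

@[simp]
theorem decode_spreadTail (p : ℕ) (δ : Cantor) : decode p (spreadTail p δ) = δ := by
  funext b
  rw [decode, spreadTail, Nat.add_sub_cancel' (le_bitPosition p b), spread_bitPosition]

theorem continuous_decode (p : ℕ) : Continuous (decode p) :=
  continuous_pi fun _ => continuous_apply _

theorem spreadTail_left_injective {p q : ℕ} {α δ : Cantor} (h : spreadTail p α = spreadTail q δ) :
    p = q := by
  obtain ⟨i, -, hi⟩ := exists_le_spreadTail_eq_one p α 0
  obtain ⟨j, hij, hj⟩ := exists_le_spreadTail_eq_one p α (i + 1)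
  obtain ⟨a, ha⟩ := exists_pow_of_spread_eq_one hi
  obtain ⟨b, hb⟩ := exists_pow_of_spread_eq_one hj
  rw [h] at hi hj
  obtain ⟨c, hc⟩ := exists_pow_of_spread_eq_one hi
  obtain ⟨d, hd⟩ := exists_pow_of_spread_eq_one hj
  exact eq_of_add_eq_pow hij ha hb hc hd

/-- A sequence with infinitely many `1`s all of whose prefixes occur in sparse sequences is a tail
of a sparse sequence. -/
theorem exists_eq_spreadTail {y : Cantor} (hy : ∀ N, ∃ i, N ≤ i ∧ y i = 1)
    (h : ∀ m, ∃ n, m ≤ n ∧ ∃ α p q, seg y 0 n = seg (spread α) p q) :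
    ∃ p δ, y = spreadTail p δ := by
  have h' : ∀ m, ∃ α p, ∀ k < m, y k = spread α (p + k) := by
    intro m
    obtain ⟨n, hmn, α, p, q, heq⟩ := h m
    refine ⟨α, p, fun k hk => ?_⟩
    have := (seg_eq_seg_iff.1 heq).2 k (by lia)
    rwa [Nat.zero_add] at this
  choose α p hαp using h'
  obtain ⟨i, -, hi⟩ := hy 0
  obtain ⟨j, hij, hj⟩ := hy (i + 1)
  have hp : ∀ m, j < m → p m = p (j + 1) := by
    intro m hm
    rw [hαp m _ (by lia)] at hi hj
    obtain ⟨a, ha⟩ := exists_pow_of_spread_eq_one hi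
    obtain ⟨b, hb⟩ := exists_pow_of_spread_eq_one hj
    rw [← hαp m _ (by lia), hαp (j + 1) _ (by lia)] at hi hj
    obtain ⟨c, hc⟩ := exists_pow_of_spread_eq_one hi
    obtain ⟨d, hd⟩ := exists_pow_of_spread_eq_one hj
    exact eq_of_add_eq_pow hij ha hb hc hd
  refine ⟨p (j + 1), decode (p (j + 1)) y, ?_⟩
  generalize p (j + 1) = P at hp
  funext k
  rw [spreadTail]
  let b := squareOffset (Nat.log 2 (P + k)) - 1
  let m := j + k + bitPosition P b + 1
  have hm : p m = P := hp m (by lia)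
  rw [hαp m k (by lia), hm]
  refine spread_congr ?_
  change α m b = y (bitPosition P b - P)
  rw [hαp m _ (by lia), hm, Nat.add_sub_cancel' (le_bitPosition P b), spread_bitPosition]

/-- The position of the cut with index `c`. -/
def cut (c : ℕ) : ℕ := 2 ^ (2 * c * (2 * c))

theorem strictMono_cut : StrictMono cut := fun _ _ h =>
  Nat.pow_lt_pow_right (le_refl 2) (Nat.mul_self_lt_mul_self (by lia))

theorem pow_lt_cut {c d r : ℕ} (h : c < d) (hr : r ≤ 4 * c + 1) :
    2 ^ (2 * c * (2 * c) + r) < cut d :=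
  Nat.pow_lt_pow_right (le_refl 2) (by nlinarith)

theorem eq_cut_of_seg_eq {α δ : Cantor} {c d p q : ℕ} (hcd : c < d)
    (h : seg (spread α) (cut c) (cut d) = seg (spread δ) p q) : p = cut c ∧ q = cut d := by
  obtain ⟨hl, hs⟩ := seg_eq_seg_iff.1 h
  have h1 := pow_lt_cut hcd (r := 4 * c + 1) le_rfl
  have h2 : 2 * c * (2 * c) + (4 * c + 1) = (2 * c + 1) * (2 * c + 1) := by ring
  have h3 : cut c < 2 ^ (2 * c * (2 * c) + (4 * c + 1)) :=
    Nat.pow_lt_pow_right (le_refl 2) (by lia)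
  rw [h2] at h1 h3
  set M := 2 ^ ((2 * c + 1) * (2 * c + 1)) with hM
  have h4 := hs 0 (by lia)
  have h5 := hs (M - cut c) (by lia)
  rw [Nat.add_zero, show spread α (cut c) = 1 from spread_marker α _] at h4
  rw [Nat.add_sub_cancel' h3.le, hM, spread_marker, ← hM] at h5
  obtain ⟨a, ha⟩ := exists_pow_of_spread_eq_one h4.symm
  obtain ⟨b, hb⟩ := exists_pow_of_spread_eq_one h5.symm
  have h6 : p = cut c := eq_of_add_eq_pow (by lia : 0 < M - cut c) ha hb rfl
    (Nat.add_sub_cancel' h3.le)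
  exact ⟨h6, by lia⟩

end Spread

section Code

/-- A number coding the first `n` terms of `γ`. -/
def code (γ : ℕ → ℕ) (n : ℕ) : ℕ := Encodable.encode ((List.range n).map γ)

theorem code_eq_code_iff {γ γ' : ℕ → ℕ} {n n' : ℕ} :
    code γ n = code γ' n' ↔ n = n' ∧ ∀ i < n, γ i = γ' i := by
  rw [code, code, Encodable.encode_injective.eq_iff]
  constructor
  · intro h
    have hn : n = n' := by simpa using congrArg List.length h
    subst hn
    exact ⟨rfl, by simpa using h⟩
  · rintro ⟨rfl, h⟩
    simpa using h

theorem tendsto_code (γ : ℕ → ℕ) : Filter.Tendsto (code γ) Filter.atTop Filter.atTop :=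
  Function.Injective.nat_tendsto_atTop fun _ _ h => (code_eq_code_iff.1 h).1

end Code

section Words

variable {F : Set (Cantor × (ℕ → ℕ))}

/-- The words which occur in no sparse sequence, together with the blocks, between two cuts coding
prefixes of the same `γ`, of the sparse sequence of some `α` such that `(α, γ) ∈ F`. -/
def words (F : Set (Cantor × (ℕ → ℕ))) : Set (List (Fin 2)) :=
  {w | (∀ α p q, w ≠ seg (spread α) p q) ∨ ∃ α γ m n, m < n ∧ code γ m < code γ n ∧ (α, γ) ∈ F ∧
    w = seg (spread α) (cut (code γ m)) (cut (code γ n))}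

theorem nil_notMem_words (F : Set (Cantor × (ℕ → ℕ))) : [] ∉ words F := by
  rintro (h | ⟨α, γ, m, n, -, h, -, hw⟩)
  · exact h 0 0 0 (by simp [seg])
  · have h1 := congrArg List.length hw
    rw [length_seg, List.length_nil] at h1
    have := strictMono_cut h
    lia

theorem exists_eq_one_of_seg_mem_words {y : Cantor} {a b : ℕ} (h : seg y a b ∈ words F) :
    ∃ i, a ≤ i ∧ y i = 1 := by
  rcases h with h | ⟨α, γ, m, n, -, h, -, hw⟩
  · by_contra! hne
    refine h 0 (2 ^ (b - a) + 1) (2 ^ (b - a) + 1 + (b - a)) ?_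
    refine seg_eq_seg_iff.2 ⟨by lia, fun i hi => ?_⟩
    rw [Fin.eq_zero_of_ne_one (hne (a + i) (by lia))]
    refine (Fin.eq_zero_of_ne_one fun h1 => ?_).symm
    obtain ⟨T, hT⟩ := exists_pow_of_spread_eq_one h1
    have h2 : b - a < 2 ^ (b - a) := Nat.lt_two_pow_self
    have h3 : b - a < T := (Nat.pow_lt_pow_iff_right (le_refl 2)).1 (by lia)
    have h4 : 2 ^ (b - a + 1) ≤ 2 ^ T := Nat.pow_le_pow_right (by lia) h3
    rw [pow_succ] at h4
    lia
  · obtain ⟨hl, hs⟩ := seg_eq_seg_iff.1 hw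
    have := strictMono_cut h
    exact ⟨a, le_rfl, (hs 0 (by lia)).trans (spread_marker α _)⟩

theorem seg_spreadTail (p : ℕ) (δ : Cantor) (a b : ℕ) :
    seg (spreadTail p δ) a b = seg (spread δ) (p + a) (p + b) :=
  seg_eq_seg_iff.2 ⟨by lia, fun i _ => by rw [spreadTail, add_assoc]⟩

theorem spreadTail_mem_omegaPower_words {δ : Cantor} {γ : ℕ → ℕ} (h : (δ, γ) ∈ F) (n : ℕ) :
    spreadTail (cut (code γ n)) δ ∈ omegaPower (words F) := by
  refine mem_omegaPower_of_step (nil_notMem_words F)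
    (fun q => ∃ m, cut (code γ m) = cut (code γ n) + q) ⟨n, rfl⟩ ?_
  rintro q ⟨m, hm⟩
  obtain ⟨m', h1, h2⟩ := ((tendsto_code γ).eventually_gt_atTop (code γ m)).and
    (Filter.eventually_gt_atTop m) |>.exists
  have h3 := strictMono_cut h1
  have h4 : cut (code γ n) + (cut (code γ m') - cut (code γ n)) = cut (code γ m') := by lia
  refine ⟨cut (code γ m') - cut (code γ n), by lia, ⟨m', h4.symm⟩,
    .inr ⟨δ, γ, m, m', h2, h1, h, ?_⟩⟩
  rw [seg_spreadTail, ← hm, h4]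

theorem mem_omegaPower_of_tail {β : Type*} {A : Set (List β)} (hA : [] ∉ A) {y : ℕ → β} {a : ℕ}
    (h : seg y 0 a ∈ A) (hy : (fun i => y (a + i)) ∈ omegaPower A) : y ∈ omegaPower A := by
  obtain ⟨l, hl, h0, hs⟩ := (mem_omegaPower_iff hA).1 hy
  have ha : 0 < a := Nat.pos_of_ne_zero fun ha => hA (by simpa [ha, seg] using h)
  refine (mem_omegaPower_iff hA).2 ⟨fun i => if i = 0 then 0 else a + l (i - 1),
    strictMono_nat_of_lt_succ fun i => ?_, rfl, fun i => ?_⟩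
  · cases i with
    | zero => simpa using by lia
    | succ i => simpa using hl (Nat.lt_succ_self i)
  · cases i with
    | zero => simpa [h0] using h
    | succ i =>
      have := hs i
      rwa [show seg (fun i => y (a + i)) (l i) (l (i + 1)) = seg y (a + l i) (a + l (i + 1)) from
        seg_eq_seg_iff.2 ⟨by lia, fun k _ => by rw [add_assoc]⟩] at this

theorem exists_seg_mem_words {y : Cantor} (hy : ∀ N, ∃ i, N ≤ i ∧ y i = 1)
    (h : ¬∃ p δ, y = spreadTail p δ) : ∃ m, ∀ n, m ≤ n → seg y 0 n ∈ words F := by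
  by_contra! hne
  refine h (exists_eq_spreadTail hy fun m => ?_)
  obtain ⟨n, hmn, hn⟩ := hne m
  refine ⟨n, hmn, ?_⟩
  by_contra! hno
  exact hn (.inl hno)

theorem exists_mem_of_spreadTail_mem_omegaPower_words (hF : IsClosed F) {p : ℕ} {δ : Cantor}
    (h : spreadTail p δ ∈ omegaPower (words F)) :
    ∃ γ n, cut (code γ n) = p ∧ (δ, γ) ∈ F := by
  obtain ⟨l, hl, h0, hs⟩ := (mem_omegaPower_iff (nil_notMem_words F)).1 h
  have key : ∀ i, ∃ α γ m n, m < n ∧ code γ m < code γ n ∧ (α, γ) ∈ F ∧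
      seg (spread α) (cut (code γ m)) (cut (code γ n)) =
        seg (spread δ) (p + l i) (p + l (i + 1)) := by
    intro i
    have := hs i
    rw [seg_spreadTail] at this
    rcases this with hw | ⟨α, γ, m, n, h1, h2, h3, h4⟩
    · exact absurd rfl (hw _ _ _)
    · exact ⟨α, γ, m, n, h1, h2, h3, h4.symm⟩
  choose α γ m n hmn hc hmem hseg using key
  have hm : ∀ i, p + l i = cut (code (γ i) (m i)) := fun i => (eq_cut_of_seg_eq (hc i) (hseg i)).1
  have hn : ∀ i, p + l (i + 1) = cut (code (γ i) (n i)) := fun i =>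
    (eq_cut_of_seg_eq (hc i) (hseg i)).2
  have hstep : ∀ i, n i = m (i + 1) ∧ ∀ k < n i, γ i k = γ (i + 1) k := fun i =>
    code_eq_code_iff.1 (strictMono_cut.injective ((hn i).symm.trans (hm (i + 1))))
  have hm_le : ∀ i, i ≤ m i := by
    intro i
    induction i with
    | zero => exact Nat.zero_le _
    | succ i ih =>
      have := hmn i
      have := (hstep i).1
      lia
  have hc_le : ∀ i, i ≤ code (γ i) (m i) := by
    intro i
    induction i with
    | zero => exact Nat.zero_le _
    | succ i ih =>
      have h1 := hc i
      have h2 := strictMono_cut.injective ((hn i).symm.trans (hm (i + 1)))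
      lia
  have hagree : ∀ k i, k < i → γ i k = γ (k + 1) k := by
    intro k i hki
    induction i, hki using Nat.le_induction with
    | base => rfl
    | succ i hi ih =>
      rw [← (hstep i).2 k ((hi.trans (hm_le i)).trans (hmn i).le), ih]
  have hbit : ∀ b i, b < i → α i b = δ b := by
    intro b i hbi
    have h1 := hc_le i
    obtain ⟨h2, h3⟩ := seg_eq_seg_iff.1 (hseg i)
    have h4 := pow_lt_cut (hc i) (r := b + 1) (by lia)
    have h5 : cut (code (γ i) (m i)) ≤
        2 ^ (2 * code (γ i) (m i) * (2 * code (γ i) (m i)) + (b + 1)) :=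
      Nat.pow_le_pow_right (by lia) (by lia)
    have h6 := h3 (2 ^ (2 * code (γ i) (m i) * (2 * code (γ i) (m i)) + (b + 1)) -
      cut (code (γ i) (m i))) (by lia)
    rwa [hm i, Nat.add_sub_cancel' h5, ← add_assoc, spread_bit _ (by lia),
      spread_bit _ (by lia)] at h6
  have hlim : Filter.Tendsto (fun i => (α i, γ i)) Filter.atTop
      (𝓝 (δ, fun k => γ (k + 1) k)) := by
    refine Filter.Tendsto.prodMk_nhds (tendsto_pi_nhds.2 fun b => ?_)
      (tendsto_pi_nhds.2 fun k => ?_)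
    · exact tendsto_const_nhds.congr' <| (Filter.eventually_gt_atTop b).mono fun i hi =>
        (hbit b i hi).symm
    · exact tendsto_const_nhds.congr' <| (Filter.eventually_gt_atTop k).mono fun i hi =>
        (hagree k i hi).symm
  have h0' := hm 0
  rw [h0, Nat.add_zero] at h0'
  refine ⟨fun k => γ (k + 1) k, m 0, ?_, hF.mem_of_tendsto hlim (.of_forall hmem)⟩
  rw [h0']
  congr 1
  refine code_eq_code_iff.2 ⟨rfl, fun k hk => ?_⟩
  have hall : ∀ i, m 0 ≤ m i ∧ γ i k = γ 0 k := by
    intro i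
    induction i with
    | zero => exact ⟨le_rfl, rfl⟩
    | succ i ih =>
      have h1 := hstep i
      have h2 := hmn i
      exact ⟨by lia, (h1.2 k (by lia)).symm.trans ih.2⟩
  exact (hall (k + 1)).2

theorem mem_omegaPower_words_iff (hF : IsClosed F) (htot : ∀ α, ∃ γ, (α, γ) ∈ F) {y : Cantor} :
    y ∈ omegaPower (words F) ↔ (∀ N, ∃ i, N ≤ i ∧ y i = 1) ∧
      ∀ p δ, y = spreadTail p δ → ∃ γ n, cut (code γ n) = p ∧ (δ, γ) ∈ F := by
  constructor
  · intro h
    refine ⟨fun N => ?_, fun p δ hp => ?_⟩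
    · obtain ⟨l, hl, -, hs⟩ := (mem_omegaPower_iff (nil_notMem_words F)).1 h
      obtain ⟨i, h1, h2⟩ := exists_eq_one_of_seg_mem_words (hs N)
      exact ⟨i, hl.le_apply.trans h1, h2⟩
    · exact exists_mem_of_spreadTail_mem_omegaPower_words hF (hp ▸ h)
  · rintro ⟨hy, h⟩
    by_cases hex : ∃ p δ, y = spreadTail p δ
    · obtain ⟨p, δ, rfl⟩ := hex
      obtain ⟨γ, n, rfl, hγ⟩ := h p δ rfl
      exact spreadTail_mem_omegaPower_words hγ n
    by_cases htail : ∃ r p δ, (fun i => y (r + i)) = spreadTail p δ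
    · obtain ⟨r, p, δ, hr⟩ := htail
      obtain ⟨m, hm⟩ := exists_seg_mem_words (F := F) hy hex
      obtain ⟨γ, hγ⟩ := htot δ
      obtain ⟨n, hn⟩ := ((tendsto_code γ).eventually_ge_atTop (p + m)).exists
      have h1 : code γ n ≤ cut (code γ n) := strictMono_cut.le_apply
      refine mem_omegaPower_of_tail (nil_notMem_words F) (hm (r + (cut (code γ n) - p)) (by lia)) ?_
      convert spreadTail_mem_omegaPower_words hγ n using 1
      funext i
      rw [add_assoc, show y (r + (cut (code γ n) - p + i)) = _ from
        congrFun hr (cut (code γ n) - p + i), spreadTail, spreadTail]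
      congr 1
      lia
    · refine mem_omegaPower_of_step (nil_notMem_words F) (fun _ => True) trivial fun q _ => ?_
      obtain ⟨m, hm⟩ := exists_seg_mem_words (F := F) (y := fun i => y (q + i)) (fun N => by
        obtain ⟨i, h1, h2⟩ := hy (q + N)
        exact ⟨i - q, by lia, by rwa [Nat.add_sub_cancel' (by lia)]⟩)
        (not_exists.1 htail q)
      refine ⟨q + (m + 1), by lia, trivial, ?_⟩
      rw [← show seg (fun i => y (q + i)) 0 (m + 1) = seg y q (q + (m + 1)) from
        seg_eq_seg_iff.2 ⟨by lia, fun k _ => by rw [Nat.zero_add]⟩]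
      exact hm _ (by lia)

theorem accepted_mem_dualDiff {ξ : Ordinal.{0}} (hF : ∀ I v, fiber F I v ∈ DualDiff Cantor ξ)
    (hempty : ∅ ∈ DualDiff Cantor ξ) (p : ℕ) :
    {δ | ∃ γ n, cut (code γ n) = p ∧ (δ, γ) ∈ F} ∈ DualDiff Cantor ξ := by
  by_cases h : ∃ γ n, cut (code γ n) = p
  · obtain ⟨γ₀, n₀, rfl⟩ := h
    convert hF (Set.Iio n₀) γ₀ using 1
    ext δ
    constructor
    · rintro ⟨γ, n, h1, h2⟩
      obtain ⟨rfl, h3⟩ := code_eq_code_iff.1 (strictMono_cut.injective h1)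
      exact ⟨γ, h2, h3⟩
    · rintro ⟨γ, h1, h2⟩
      exact ⟨γ, n₀, congrArg cut (code_eq_code_iff.2 ⟨rfl, h2⟩), h1⟩
  · convert hempty using 1
    ext δ
    exact iff_of_false (fun ⟨γ, n, h1, _⟩ => h ⟨γ, n, h1⟩) id

theorem omegaPower_words_mem_dualDiff {ξ : Ordinal.{0}} (hξ : 1 < ξ) (hF : IsClosed F)
    (htot : ∀ α, ∃ γ, (α, γ) ∈ F) (hfib : ∀ I v, fiber F I v ∈ DualDiff Cantor ξ) :
    omegaPower (words F) ∈ DualDiff Cantor ξ := by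
  have hempty : (∅ : Set Cantor) ∈ DualDiff Cantor ξ :=
    mem_dualDiff_of_sigmaZero (isOpen_empty.mem_sigmaZero ξ)
  choose B hB C hC hBC using accepted_mem_dualDiff hfib hempty
  let G : ℕ → Set Cantor := fun p => {y | y = spreadTail p (decode p y)}
  have hG : ∀ p, IsClosed (G p) := fun p =>
    isClosed_eq continuous_id ((continuous_spreadTail p).comp (continuous_decode p))
  let E : Set Cantor := ⋃ N, ⋂ i, {y | N ≤ i → y i ≠ 1}
  have hE : E ∈ SigmaZero Cantor ξ := by
    refine iUnion_mem_sigmaZero fun N => IsClosed.mem_sigmaZero hξ (isClosed_iInter fun i => ?_)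
    have h : Continuous fun y : Cantor => y i := continuous_apply i
    exact (isClosed_discrete {c : Fin 2 | N ≤ i → c ≠ 1}).preimage h
  refine ⟨⋃ p, G p ∩ decode p ⁻¹' B p, iUnion_mem_sigmaZero fun p => inter_mem_sigmaZero
    ((hG p).mem_sigmaZero hξ) (preimage_mem_sigmaZero (continuous_decode p) ξ _ (hB p)),
    (E ∪ ⋃ p, G p ∩ decode p ⁻¹' (C p)ᶜ)ᶜ, compl_mem_piZero.2 (union_mem_sigmaZero hE
    (iUnion_mem_sigmaZero fun p => inter_mem_sigmaZero ((hG p).mem_sigmaZero hξ)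
    (preimage_mem_sigmaZero (continuous_decode p) ξ _ (hC p)))), ?_⟩
  ext y
  rw [mem_omegaPower_words_iff hF htot]
  by_cases hy : ∃ p δ, y = spreadTail p δ
  · obtain ⟨p, δ, rfl⟩ := hy
    have hGq : ∀ q, spreadTail p δ ∈ G q ↔ p = q := fun q =>
      ⟨fun h => spreadTail_left_injective h, by rintro rfl; simp [G]⟩
    have hone := exists_le_spreadTail_eq_one p δ
    have hnE : spreadTail p δ ∉ E := by
      simpa [E] using hone
    have h1 : (∃ γ n, cut (code γ n) = p ∧ (δ, γ) ∈ F) ↔ δ ∈ B p ∪ C p := by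
      rw [← hBC]; rfl
    have h2 : (∀ q ε, spreadTail p δ = spreadTail q ε →
        ∃ γ n, cut (code γ n) = q ∧ (ε, γ) ∈ F) ↔ δ ∈ B p ∪ C p := by
      rw [← h1]
      refine ⟨fun h => h p δ rfl, fun h q ε hq => ?_⟩
      obtain rfl := spreadTail_left_injective hq
      have := congrArg (decode p) hq
      rw [decode_spreadTail, decode_spreadTail] at this
      exact this ▸ h
    rw [and_iff_right hone, h2]
    simp [hGq, hnE]
  · have hGq : ∀ q, y ∉ G q := fun q h => hy ⟨q, _, h⟩
    rw [and_iff_left fun p δ h => (hy ⟨p, δ, h⟩).elim]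
    simp [hGq, E]

end Words

section Main

theorem exists_reduction_words {s : Set Cantor} {F : Set (Cantor × (ℕ → ℕ))} (hF : IsClosed F)
    (hs : ∀ α, α ∈ s ↔ ∃ γ, (α, γ) ∈ F ∧ γ 0 = 0) :
    ∃ f : Cantor → Cantor, Continuous f ∧ s = f ⁻¹' omegaPower (words F) := by
  refine ⟨spreadTail (cut (code 0 1)), continuous_spreadTail _, ?_⟩
  ext δ
  rw [hs, Set.mem_preimage]
  constructor
  · rintro ⟨γ, h1, h2⟩
    have h3 : code 0 1 = code γ 1 := code_eq_code_iff.2 ⟨rfl, fun i hi => by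
      rw [Nat.lt_one_iff.1 hi, h2]; rfl⟩
    rw [h3]
    exact spreadTail_mem_omegaPower_words h1 1
  · intro h
    obtain ⟨γ, n, h1, h2⟩ := exists_mem_of_spreadTail_mem_omegaPower_words hF h
    obtain ⟨rfl, h3⟩ := code_eq_code_iff.1 (strictMono_cut.injective h1)
    exact ⟨γ, h2, h3 0 Nat.one_pos⟩

theorem exists_omegaPower_reduction {ξ : Ordinal.{0}} (hξ : 1 ≤ ξ) {s : Set Cantor}
    (hs : s ∈ DualDiff Cantor ξ) :
    ∃ A : Set (List (Fin 2)), omegaPower A ∈ DualDiff Cantor ξ ∧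
      ∃ f : Cantor → Cantor, Continuous f ∧ s = f ⁻¹' omegaPower A := by
  rcases hξ.eq_or_lt with rfl | h
  · exact ⟨openWords, omegaPower_openWords_mem_dualDiff le_rfl,
      exists_reduction_openWords le_rfl cantor_zeroDim hs⟩
  · obtain ⟨F, hF, htot, hsF, hfib⟩ := exists_pointed_presentation hξ hs
    exact ⟨words F, omegaPower_words_mem_dualDiff h hF htot hfib, exists_reduction_words hF hsF⟩

end Main

/-- For every countable ordinal ξ ≥ 1 there is a set A of finite binary words whose
ω-power is Ď₂(Σ⁰_ξ)-complete: A^∞ = B ∪ C with B ∈ Σ⁰_ξ and C ∈ Π⁰_ξ, every set of this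
form in a zero-dimensional Polish space is a continuous preimage of A^∞, and A^∞ is not a
difference of two Σ⁰_ξ(2^ω) sets. -/
theorem check_d2_complete_omega_power (ξ : Ordinal.{0}) (hξ : 1 ≤ ξ)
    (hcount : ξ.card ≤ Cardinal.aleph0) :
    ∃ A : Set (List (Fin 2)),
      (∃ B ∈ SigmaZero Cantor ξ, ∃ C ∈ PiZero Cantor ξ, omegaPower A = B ∪ C) ∧
      (∀ (X : Type) [TopologicalSpace X] [PolishSpace X], ZeroDim X →
        ∀ S : Set X, (∃ B' ∈ SigmaZero X ξ, ∃ C' ∈ PiZero X ξ, S = B' ∪ C') →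
          ∃ f : X → Cantor, Continuous f ∧ S = f ⁻¹' omegaPower A) ∧
      ¬ ∃ B ∈ SigmaZero Cantor ξ, ∃ C ∈ SigmaZero Cantor ξ, omegaPower A = B \ C := by
  obtain ⟨V, hV, hhard, hdiff⟩ := exists_complete_dualDiff ξ hcount
  obtain ⟨A, hA, f, hf, rfl⟩ := exists_omegaPower_reduction hξ hV
  refine ⟨A, hA, fun X _ _ hX S hS => ?_, ?_⟩
  · obtain ⟨g, hg, rfl⟩ := hhard X hX S hS
    exact ⟨f ∘ g, hf.comp hg, rfl⟩
  · rintro ⟨B, hB, C, hC, h⟩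
    refine hdiff ⟨f ⁻¹' B, preimage_mem_sigmaZero hf ξ _ hB, f ⁻¹' C,
      preimage_mem_sigmaZero hf ξ _ hC, ?_⟩
    rw [h, Set.preimage_sdiff]
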